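/- Iterated regularized integral of a homogeneous function, non-critical case: Let f ∈ C^∞(ℝ₊² \ {(0,0)}) be homogeneous of degree α ∈ ℂ with α + 2 ≠ 0, and let a, b ≥ 0 with a + b > 0. Then ⨍_a^∞ ⨍_b^∞ f(x,y) dy dx = ⨍_b^∞ ⨍_a^∞ f(x,y) dx dy = -(a^{α+2}/(α+2)) ⨍_{b/a}^∞ f(1,y) dy - (b^{α+2}/(α+2)) ⨍_{a/b}^∞ f(x,1) dx - c_{α+1} ⨍_a^∞ x^{α+1} log x dx - d_{α+1} ⨍_b^∞ x^{α+1} log x dx. In particular the two orders of iterated regularized integration agree. -/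

import Mathlib

open MeasureTheory Filter Asymptotics

noncomputable section

/-- A term `x ^ α * (log x) ^ k` of a partie-finie asymptotic expansion. -/
def CTerm (p : ℂ × ℕ) (x : ℝ) : ℂ :=
  (x : ℂ) ^ p.1 * (Real.log x : ℂ) ^ p.2

/-- Hadamard partie finie regularized limit as `x → ∞`: `g` has an asymptotic expansion
`g(x) ~ ∑ A p * x ^ p.1 * log x ^ p.2 + c + o(1)` where all expansion terms are
non-decaying and non-constant; `c` is the constant term `a₀₀`. -/
def HasRegLimAtTop (g : ℝ → ℂ) (c : ℂ) : Prop :=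
  ∃ (s : Finset (ℂ × ℕ)) (A : ℂ × ℕ → ℂ),
    (∀ p ∈ s, 0 ≤ p.1.re ∧ p ≠ (0, 0)) ∧
    Tendsto (fun x => g x - ∑ p ∈ s, A p * CTerm p x - c) atTop (nhds 0)

/-- Hadamard partie finie regularized limit as `x → 0⁺`. -/
def HasRegLimAtZero (g : ℝ → ℂ) (c : ℂ) : Prop :=
  ∃ (s : Finset (ℂ × ℕ)) (A : ℂ × ℕ → ℂ),
    (∀ p ∈ s, p.1.re ≤ 0 ∧ p ≠ (0, 0)) ∧
    Tendsto (fun x => g x - ∑ p ∈ s, A p * CTerm p x - c) (nhdsWithin 0 (Set.Ioi 0)) (nhds 0)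

/-- `⨍_a^∞ g = v` : the regularized integral of `g` from `a` to `∞` equals `v`.
For `a ≠ 0` it is `LIM_{R→∞} ∫_a^R g`; for `a = 0` one additionally regularizes at the
lower endpoint: `⨍_0^∞ g = LIM_{ε→0} ∫_ε^1 g + LIM_{R→∞} ∫_1^R g`. -/
def HasRegInt (g : ℝ → ℂ) (a : ℝ) (v : ℂ) : Prop :=
  (a ≠ 0 ∧ HasRegLimAtTop (fun R => ∫ x in a..R, g x) v) ∨
  (a = 0 ∧ ∃ v₀ v₁ : ℂ,
    HasRegLimAtZero (fun e => ∫ x in e..1, g x) v₀ ∧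
    HasRegLimAtTop (fun R => ∫ x in (1:ℝ)..R, g x) v₁ ∧ v = v₀ + v₁)

/-- Regularized limit of a sequence (partie finie of the expansion in `N`). -/
def HasRegLimSeq (g : ℕ → ℂ) (c : ℂ) : Prop :=
  ∃ (s : Finset (ℂ × ℕ)) (A : ℂ × ℕ → ℂ),
    (∀ p ∈ s, 0 ≤ p.1.re ∧ p ≠ (0, 0)) ∧
    Tendsto (fun N : ℕ => g N - ∑ p ∈ s, A p * CTerm p (N : ℝ) - c) atTop (nhds 0)

/-- Regularized sum `Σ-reg_{l=l₀}^∞ g l = v`, the regularized limit of partial sums. -/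
def HasRegSum (g : ℕ → ℂ) (l₀ : ℕ) (v : ℂ) : Prop :=
  HasRegLimSeq (fun N => ∑ l ∈ Finset.Icc l₀ N, g l) v

/-- The closed quarter plane minus the origin. -/
def Qset : Set (ℝ × ℝ) := {p | 0 ≤ p.1 ∧ 0 ≤ p.2} \ {0}

/-- Homogeneity of complex degree `α` on the quarter plane. -/
def Homog (f : ℝ × ℝ → ℂ) (α : ℂ) : Prop :=
  ∀ l : ℝ, 0 < l → ∀ p : ℝ × ℝ, p ∈ Qset →
    f (l * p.1, l * p.2) = (l : ℂ) ^ α * f p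

/-- Taylor coefficient `c_j = (∂₁^j f)(0,1)/j!` of the expansion of `f` as `y → ∞`. -/
def cCoef (f : ℝ × ℝ → ℂ) (j : ℕ) : ℂ :=
  (j.factorial : ℂ)⁻¹ * iteratedDerivWithin j (fun t => f (t, 1)) (Set.Ici 0) 0

/-- Taylor coefficient `d_j = (∂₂^j f)(1,0)/j!` of the expansion of `f` as `x → ∞`. -/
def dCoef (f : ℝ × ℝ → ℂ) (j : ℕ) : ℂ :=
  (j.factorial : ℂ)⁻¹ * iteratedDerivWithin j (fun t => f (1, t)) (Set.Ici 0) 0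

open Classical in
/-- `c_{α+1}`: the coefficient `c_j` with `j = α + 1` if `α + 1 ∈ ℕ`, and `0` otherwise. -/
def cCrit (f : ℝ × ℝ → ℂ) (α : ℂ) : ℂ :=
  if h : ∃ j : ℕ, α + 1 = (j : ℂ) then cCoef f h.choose else 0

open Classical in
/-- `d_{α+1}`: the coefficient `d_j` with `j = α + 1` if `α + 1 ∈ ℕ`, and `0` otherwise. -/
def dCrit (f : ℝ × ℝ → ℂ) (α : ℂ) : ℂ :=
  if h : ∃ j : ℕ, α + 1 = (j : ℂ) then dCoef f h.choose else 0

end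

/-- Exponential polynomials with exponents of nonnegative real part that tend to `0` vanish. -/
theorem exp_poly_eq_zero_of_tendsto (S : Finset ℂ) :
    (∀ μ ∈ S, 0 ≤ μ.re) → ∀ P : ℂ → Polynomial ℂ,
      Tendsto (fun t : ℝ => ∑ μ ∈ S, (P μ).eval (t : ℂ) * Complex.exp (μ * t)) atTop (nhds 0) →
      ∀ μ ∈ S, P μ = 0 := by
  induction S using Finset.induction_on with
  | empty => simp
  | insert l S hl ih =>
    intro hre P hP
    have main : ∀ n : ℕ, ∀ P : ℂ → Polynomial ℂ, (P l).degree < n →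
        Tendsto (fun t : ℝ => ∑ μ ∈ insert l S, (P μ).eval (t : ℂ) * Complex.exp (μ * t))
          atTop (nhds 0) → ∀ μ ∈ insert l S, P μ = 0 := by
      intro n
      induction n with
      | zero =>
        intro P hdeg hP
        have h0 : P l = 0 := by
          rw [← Polynomial.degree_eq_bot]
          simpa [Nat.WithBot.lt_zero_iff] using hdeg
        simp only [Finset.sum_insert hl, h0, Polynomial.eval_zero, zero_mul, zero_add] at hP
        intro μ hμ
        rcases Finset.mem_insert.1 hμ with rfl | hμ
        · exact h0
        · exact ih (fun ν hν => hre ν (Finset.mem_insert_of_mem hν)) P hP μ hμ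
      | succ n ihn =>
        intro P hdeg hP
        have key : ∀ τ : ℝ, ∀ μ ∈ insert l S,
            Polynomial.C (Complex.exp (μ * τ)) * Polynomial.taylor (τ : ℂ) (P μ) =
              Polynomial.C (Complex.exp (l * τ)) * P μ := by
          intro τ μ hμ
          rw [← sub_eq_zero]
          refine ihn (fun μ => Polynomial.C (Complex.exp (μ * τ)) *
            Polynomial.taylor (τ : ℂ) (P μ) - Polynomial.C (Complex.exp (l * τ)) * P μ)
            ?_ ?_ μ hμ
          · show Polynomial.degree (_ - _) < _
            rw [← mul_sub, Polynomial.degree_C_mul (Complex.exp_ne_zero _)]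
            by_cases h0 : P l = 0
            · simp [h0]
            have h1 : (Polynomial.taylor (τ : ℂ) (P l) - P l).degree < (P l).degree := by
              have := Polynomial.degree_sub_lt_left (p := Polynomial.taylor (τ : ℂ) (P l)) (q := P l)
                (by simp) (by simpa using h0) (by simp)
              simpa using this
            rw [Polynomial.degree_eq_natDegree h0] at h1 hdeg
            have h2 : (P l).natDegree ≤ n := by
              have : (P l).natDegree < n + 1 := by exact_mod_cast hdeg
              omega
            exact h1.trans_le (by exact_mod_cast h2)
          · have hs := hP.comp (tendsto_atTop_add_const_right atTop τ tendsto_id)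
            have := hs.sub (hP.const_mul (Complex.exp (l * τ)))
            simp only [mul_zero, sub_zero] at this
            refine this.congr fun t => ?_
            simp only [Function.comp, id, Finset.mul_sum, ← Finset.sum_sub_distrib]
            refine Finset.sum_congr rfl fun ν _ => ?_
            simp only [Polynomial.eval_sub, Polynomial.eval_mul, Polynomial.eval_C,
              Polynomial.taylor_eval, Complex.ofReal_add, mul_add, Complex.exp_add]
            ring
        have hS : ∀ μ ∈ S, P μ = 0 := by
          intro μ hμ
          by_contra h0
          have hne : μ - l ≠ 0 := sub_ne_zero.2 fun h => hl (h ▸ hμ)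
          have hexp : ∀ τ : ℝ, Complex.exp ((μ - l) * τ) = 1 := by
            intro τ
            have := congrArg Polynomial.leadingCoeff (key τ μ (Finset.mem_insert_of_mem hμ))
            simp only [Polynomial.leadingCoeff_mul, Polynomial.leadingCoeff_C,
              Polynomial.leadingCoeff_taylor] at this
            have h3 := mul_right_cancel₀ (Polynomial.leadingCoeff_ne_zero.2 h0) this
            rw [sub_mul, Complex.exp_sub, h3, div_self (Complex.exp_ne_zero _)]
          have hd : HasDerivAt (fun τ : ℝ => Complex.exp ((μ - l) * τ)) (μ - l) 0 := by
            have h4 : HasDerivAt (fun τ : ℝ => (μ - l) * (τ : ℂ)) ((μ - l) * 1) 0 :=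
              (Complex.ofRealCLM.hasDerivAt (x := (0 : ℝ))).const_mul (μ - l)
            have := h4.cexp
            simpa using this
          simp only [hexp] at hd
          exact hne (hd.unique (hasDerivAt_const _ _))
        have hconst : ∀ τ : ℝ, (P l).eval (τ : ℂ) = (P l).eval 0 := by
          intro τ
          have := congrArg (Polynomial.eval 0) (key τ l (Finset.mem_insert_self _ _))
          simp only [Polynomial.eval_mul, Polynomial.eval_C, Polynomial.taylor_eval,
            zero_add] at this
          exact mul_left_cancel₀ (Complex.exp_ne_zero _) this
        have hl0 : (P l).eval 0 = 0 := by
          have h5 : Tendsto (fun t : ℝ => (P l).eval 0 * Complex.exp (l * t)) atTop (nhds 0) := by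
            refine hP.congr fun t => ?_
            rw [Finset.sum_insert hl, hconst, Finset.sum_eq_zero, add_zero]
            intro ν hν
            simp [hS ν hν]
          have h6 := h5.norm
          rw [norm_zero] at h6
          have h7 : ‖(P l).eval 0‖ ≤ 0 := by
            refine ge_of_tendsto h6 ?_
            filter_upwards [eventually_ge_atTop 0] with t ht
            rw [norm_mul, Complex.norm_exp]
            refine le_mul_of_one_le_right (norm_nonneg _) (Real.one_le_exp ?_)
            have := hre l (Finset.mem_insert_self _ _)
            simp only [Complex.mul_re, Complex.ofReal_re, Complex.ofReal_im, mul_zero, sub_zero]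
            positivity
          exact norm_le_zero_iff.1 h7
        have hlz : P l = 0 := by
          refine Polynomial.eq_zero_of_infinite_isRoot _ ?_
          refine (Set.infinite_range_of_injective Complex.ofReal_injective).mono ?_
          rintro _ ⟨τ, rfl⟩
          exact (hconst τ).trans hl0
        intro μ hμ
        rcases Finset.mem_insert.1 hμ with rfl | hμ
        · exact hlz
        · exact hS μ hμ
    exact main ((P l).natDegree + 1) P
      (Polynomial.degree_le_natDegree.trans_lt (by exact_mod_cast Nat.lt_succ_self _)) hP

theorem CTerm_exp (p : ℂ × ℕ) (t : ℝ) :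
    CTerm p (Real.exp t) = (t : ℂ) ^ p.2 * Complex.exp (p.1 * t) := by
  rw [CTerm, Real.log_exp, Complex.cpow_def_of_ne_zero (by exact_mod_cast (Real.exp_pos t).ne'),
    ← Complex.ofReal_log (Real.exp_pos t).le, Real.log_exp, mul_comm, mul_comm p.1]

namespace HasRegLimAtTop

theorem eq_zero {c : ℂ} (h : HasRegLimAtTop (fun _ => 0) c) : c = 0 := by
  obtain ⟨s, A, hs, ht⟩ := h
  classical
  let P : ℂ → Polynomial ℂ := fun μ =>
    (∑ p ∈ s with p.1 = μ, Polynomial.monomial p.2 (A p)) + if μ = 0 then Polynomial.C c else 0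
  have hP : P 0 = 0 := by
    refine exp_poly_eq_zero_of_tendsto (insert 0 (s.image Prod.fst)) ?_ P ?_ 0
      (Finset.mem_insert_self _ _)
    · intro μ hμ
      rcases Finset.mem_insert.1 hμ with rfl | hμ
      · simp
      · obtain ⟨p, hp, rfl⟩ := Finset.mem_image.1 hμ
        exact (hs p hp).1
    · have := (ht.comp Real.tendsto_exp_atTop).neg
      rw [neg_zero] at this
      refine this.congr fun t => ?_
      have hfib : ∑ p ∈ s, A p * CTerm p (Real.exp t) =
          ∑ μ ∈ insert 0 (s.image Prod.fst), ∑ p ∈ s with p.1 = μ, A p * CTerm p (Real.exp t) :=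
        (Finset.sum_fiberwise_of_maps_to
          (fun p hp => Finset.mem_insert_of_mem (Finset.mem_image_of_mem _ hp)) _).symm
      have hc : ∑ μ ∈ insert 0 (s.image Prod.fst),
          (if μ = 0 then Polynomial.C c else 0).eval (t : ℂ) * Complex.exp (μ * t) = c := by
        rw [Finset.sum_eq_single_of_mem 0 (Finset.mem_insert_self _ _)]
        · simp
        · intro μ _ hμ
          simp [hμ]
      simp only [Function.comp, P, Polynomial.eval_add, add_mul, Finset.sum_add_distrib, hc, hfib,
        Polynomial.eval_finsetSum, Polynomial.eval_monomial, Finset.sum_mul]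
      rw [show ∀ z : ℂ, -(0 - z - c) = z + c from fun z => by ring]
      congr 1
      refine Finset.sum_congr rfl fun μ _ => Finset.sum_congr rfl fun p hp => ?_
      rw [CTerm_exp, (Finset.mem_filter.1 hp).2]
      ring
  have := congrArg (fun q => Polynomial.coeff q 0) hP
  simp only [P, if_true, Polynomial.coeff_add, Polynomial.finsetSum_coeff, Polynomial.coeff_C_zero,
    Polynomial.coeff_zero] at this
  rw [Finset.sum_eq_zero, zero_add] at this
  · exact this
  · intro p hp
    obtain ⟨hp, hp0⟩ := Finset.mem_filter.1 hp
    refine Polynomial.coeff_monomial_of_ne _ fun h => (hs p hp).2 ?_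
    exact Prod.ext hp0 h.symm

theorem add {g g' : ℝ → ℂ} {c c' : ℂ} (h : HasRegLimAtTop g c) (h' : HasRegLimAtTop g' c') :
    HasRegLimAtTop (fun x => g x + g' x) (c + c') := by
  obtain ⟨s, A, hs, ht⟩ := h
  obtain ⟨s', A', hs', ht'⟩ := h'
  classical
  refine ⟨s ∪ s', fun p => (if p ∈ s then A p else 0) + if p ∈ s' then A' p else 0, ?_, ?_⟩
  · intro p hp
    rcases Finset.mem_union.1 hp with hp | hp
    exacts [hs p hp, hs' p hp]
  · have := ht.add ht'
    rw [add_zero] at this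
    refine this.congr fun x => ?_
    simp only [add_mul, Finset.sum_add_distrib, ite_mul, zero_mul, Finset.sum_ite_mem,
      Finset.union_inter_cancel_left, Finset.union_inter_cancel_right]
    ring

theorem const_mul {g : ℝ → ℂ} {c : ℂ} (h : HasRegLimAtTop g c) (z : ℂ) :
    HasRegLimAtTop (fun x => z * g x) (z * c) := by
  obtain ⟨s, A, hs, ht⟩ := h
  refine ⟨s, fun p => z * A p, hs, ?_⟩
  have := ht.const_mul z
  rw [mul_zero] at this
  refine this.congr fun x => ?_
  simp only [mul_sub, Finset.mul_sum, mul_assoc]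

theorem congr' {g g' : ℝ → ℂ} {c : ℂ} (h : HasRegLimAtTop g c) (he : g =ᶠ[atTop] g') :
    HasRegLimAtTop g' c := by
  obtain ⟨s, A, hs, ht⟩ := h
  refine ⟨s, A, hs, ht.congr' ?_⟩
  filter_upwards [he] with x hx
  rw [hx]

theorem sub {g g' : ℝ → ℂ} {c c' : ℂ} (h : HasRegLimAtTop g c) (h' : HasRegLimAtTop g' c') :
    HasRegLimAtTop (fun x => g x - g' x) (c - c') := by
  have := h.add (h'.const_mul (-1))
  simpa [sub_eq_add_neg] using this

theorem unique {g : ℝ → ℂ} {c c' : ℂ} (h : HasRegLimAtTop g c) (h' : HasRegLimAtTop g c') :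
    c = c' := by
  have := h.sub h'
  simp only [sub_self] at this
  exact sub_eq_zero.1 this.eq_zero

theorem of_tendsto {g : ℝ → ℂ} {c : ℂ} (h : Tendsto g atTop (nhds c)) : HasRegLimAtTop g c := by
  refine ⟨∅, 0, by simp, ?_⟩
  simpa using h.sub_const c

theorem const (c : ℂ) : HasRegLimAtTop (fun _ => c) c :=
  of_tendsto tendsto_const_nhds

theorem sum {ι : Type*} (t : Finset ι) {g : ι → ℝ → ℂ} {c : ι → ℂ}
    (h : ∀ i ∈ t, HasRegLimAtTop (g i) (c i)) :
    HasRegLimAtTop (fun x => ∑ i ∈ t, g i x) (∑ i ∈ t, c i) := by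
  classical
  induction t using Finset.induction_on with
  | empty => simpa using const 0
  | insert i t hi ih =>
    simp only [Finset.sum_insert hi]
    exact (h i (Finset.mem_insert_self _ _)).add
      (ih fun j hj => h j (Finset.mem_insert_of_mem hj))

theorem cterm {p : ℂ × ℕ} (hp : p ≠ (0, 0)) : HasRegLimAtTop (CTerm p) 0 := by
  by_cases hre : 0 ≤ p.1.re
  · exact ⟨{p}, 1, by simpa using ⟨hre, hp⟩, by simp⟩
  · refine of_tendsto ?_
    rw [tendsto_zero_iff_norm_tendsto_zero]
    have h := (isLittleO_log_rpow_rpow_atTop (p.2 : ℝ) (neg_pos.2 (not_le.1 hre))).tendsto_div_nhds_zero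
    refine h.congr' ?_
    filter_upwards [eventually_gt_atTop 1] with x hx
    have hx0 : 0 < x := by linarith
    rw [CTerm, norm_mul, norm_pow, Complex.norm_cpow_eq_rpow_re_of_pos hx0, Complex.norm_real,
      Real.norm_of_nonneg (Real.log_nonneg hx.le), Real.rpow_natCast, Real.rpow_neg hx0.le]
    field_simp

theorem cpow {β : ℂ} (hβ : β ≠ 0) : HasRegLimAtTop (fun x => (x : ℂ) ^ β) 0 := by
  exact (cterm (p := (β, 0)) (by simpa using hβ)).congr'
    (Eventually.of_forall fun x => by simp [CTerm])

theorem cpow_mul_log (β : ℂ) : HasRegLimAtTop (fun x => (x : ℂ) ^ β * (Real.log x : ℂ)) 0 := by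
  exact (cterm (p := (β, 1)) (by simp)).congr'
    (Eventually.of_forall fun x => by simp [CTerm])

end HasRegLimAtTop

theorem HasRegLimAtZero.comp_inv {g : ℝ → ℂ} {c : ℂ} (h : HasRegLimAtZero g c) :
    HasRegLimAtTop (fun R => g R⁻¹) c := by
  obtain ⟨s, A, hs, ht⟩ := h
  have h1 := HasRegLimAtTop.of_tendsto (ht.comp tendsto_inv_atTop_nhdsGT_zero)
  have h2 : ∀ p ∈ s, HasRegLimAtTop (fun R => A p * CTerm p R⁻¹) 0 := by
    intro p hp
    have h3 := ((HasRegLimAtTop.cterm (p := (-p.1, p.2)) (by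
      intro h
      simp only [Prod.mk.injEq, neg_eq_zero] at h
      exact (hs p hp).2 (Prod.ext h.1 h.2))).const_mul ((-1) ^ p.2)).const_mul (A p)
    simp only [mul_zero] at h3
    refine h3.congr' ?_
    filter_upwards [eventually_gt_atTop 0] with R hR
    rw [CTerm, CTerm, Real.log_inv, Complex.ofReal_inv, Complex.inv_cpow, Complex.cpow_neg,
      Complex.ofReal_neg, neg_pow (Real.log R : ℂ)]
    · ring
    · rw [Complex.arg_ofReal_of_nonneg hR.le]
      exact Real.pi_pos.ne
  have h4 := (h1.add (HasRegLimAtTop.sum s h2)).add (HasRegLimAtTop.const c)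
  simp only [Finset.sum_const_zero, zero_add] at h4
  refine h4.congr' (Eventually.of_forall fun R => ?_)
  simp only [Function.comp]
  ring

theorem integral_eq_sub_of_primitive {g Φ : ℝ → ℂ} (hg : ContinuousOn g (Set.Ioi 0))
    (hΦ : ∀ x : ℝ, 0 < x → HasDerivAt Φ (g x) x) {s t : ℝ} (hs : 0 < s) (ht : 0 < t) :
    ∫ x in s..t, g x = Φ t - Φ s := by
  have hsub : Set.uIcc s t ⊆ Set.Ioi 0 := fun x hx => (lt_min hs ht).trans_le hx.1
  exact intervalIntegral.integral_eq_sub_of_hasDerivAt (fun x hx => hΦ x (hsub hx))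
    (hg.mono hsub).intervalIntegrable

/-- A regularized integral with positive lower endpoint, computed from a primitive. -/
theorem HasRegInt.eq_sub_of_primitive {g Φ : ℝ → ℂ} {a : ℝ} {v w : ℂ} (ha : 0 < a)
    (hg : ContinuousOn g (Set.Ioi 0)) (hΦ : ∀ x : ℝ, 0 < x → HasDerivAt Φ (g x) x)
    (hw : HasRegLimAtTop Φ w) (h : HasRegInt g a v) : v = w - Φ a := by
  rcases h with ⟨-, h⟩ | ⟨h0, -⟩
  · refine h.unique ((hw.sub (HasRegLimAtTop.const (Φ a))).congr' ?_)
    filter_upwards [eventually_gt_atTop 0] with R hR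
    exact (integral_eq_sub_of_primitive hg hΦ ha hR).symm
  · exact absurd h0 ha.ne'

/-- A regularized integral over the half line, computed from a primitive. -/
theorem HasRegInt.eq_sub_of_primitive_zero {g Φ : ℝ → ℂ} {v w w₀ : ℂ}
    (hg : ContinuousOn g (Set.Ioi 0)) (hΦ : ∀ x : ℝ, 0 < x → HasDerivAt Φ (g x) x)
    (hw : HasRegLimAtTop Φ w) (hw₀ : HasRegLimAtTop (fun R => Φ R⁻¹) w₀)
    (h : HasRegInt g 0 v) : v = w - w₀ := by
  rcases h with ⟨h0, -⟩ | ⟨-, v₀, v₁, h₀, h₁, rfl⟩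
  · exact absurd rfl h0
  · have e₁ : v₁ = w - Φ 1 :=
      HasRegInt.eq_sub_of_primitive one_pos hg hΦ hw (Or.inl ⟨one_ne_zero, h₁⟩)
    have e₀ : v₀ = Φ 1 - w₀ := by
      refine h₀.comp_inv.unique (((HasRegLimAtTop.const (Φ 1)).sub hw₀).congr' ?_)
      filter_upwards [eventually_gt_atTop 0] with R hR
      exact (integral_eq_sub_of_primitive hg hΦ (inv_pos.2 hR) one_pos).symm
    rw [e₀, e₁]
    ring

/-- The `j`-th Taylor coefficient at `0` of a function on the half line. -/
noncomputable def taylorCoef (k : ℝ → ℂ) (j : ℕ) : ℂ :=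
  (j.factorial : ℂ)⁻¹ * iteratedDerivWithin j k (Set.Ici 0) 0

open Classical in
/-- The Taylor coefficient of index `α + 1`, and `0` if `α + 1` is not a natural number. -/
noncomputable def critCoef (k : ℝ → ℂ) (α : ℂ) : ℂ :=
  if h : ∃ j : ℕ, α + 1 = (j : ℂ) then taylorCoef k h.choose else 0

theorem critCoef_of_eq {k : ℝ → ℂ} {α : ℂ} {j : ℕ} (h : α + 1 = j) :
    critCoef k α = taylorCoef k j := by
  have hex : ∃ j : ℕ, α + 1 = (j : ℂ) := ⟨j, h⟩
  have : hex.choose = j := by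
    exact_mod_cast hex.choose_spec.symm.trans h
  rw [critCoef, dif_pos hex, this]

theorem sum_taylorCoef_mul_ite (k : ℝ → ℂ) {α : ℂ} {N : ℕ} (hN : α.re + 1 < N) (X : ℂ) :
    ∑ j ∈ Finset.range N, taylorCoef k j * (if α + 1 = j then X else 0) = critCoef k α * X := by
  by_cases hex : ∃ j : ℕ, α + 1 = (j : ℂ)
  · obtain ⟨j, hj⟩ := hex
    have hjN : j < N := by
      have : α.re + 1 = j := by simpa using congrArg Complex.re hj
      exact_mod_cast this ▸ hN
    rw [Finset.sum_eq_single_of_mem j (Finset.mem_range.2 hjN), if_pos hj, critCoef_of_eq hj]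
    intro i _ hi
    rw [if_neg, mul_zero]
    rw [hj]
    exact_mod_cast hi.symm
  · rw [critCoef, dif_neg hex, zero_mul]
    refine Finset.sum_eq_zero fun j _ => ?_
    rw [if_neg fun h => hex ⟨j, h⟩, mul_zero]

theorem exists_taylorCoef_bound {k : ℝ → ℂ} (hk : ContDiffOn ℝ (⊤ : ℕ∞) k (Set.Ici 0)) (n : ℕ) :
    ∃ C : ℝ, 0 ≤ C ∧ ∀ t ∈ Set.Icc (0 : ℝ) 1,
      ‖k t - ∑ j ∈ Finset.range (n + 1), taylorCoef k j * (t : ℂ) ^ j‖ ≤ C * t ^ (n + 1) := by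
  obtain ⟨C, hC⟩ := exists_taylor_mean_remainder_bound (f := k) (n := n) zero_le_one
    ((hk.of_le (by exact_mod_cast le_top)).mono Set.Icc_subset_Ici_self)
  refine ⟨|C|, abs_nonneg C, fun t ht => ?_⟩
  have h1 := hC t ht
  rw [taylor_within_apply, sub_zero] at h1
  have hset : (Set.Icc 0 1 : Set ℝ) =ᶠ[nhds 0] Set.Ici 0 := by
    filter_upwards [eventually_le_nhds (zero_lt_one' ℝ)] with x hx
    exact propext ⟨fun h => h.1, fun h => ⟨h, hx⟩⟩
  have h2 : ∀ j : ℕ, iteratedDerivWithin j k (Set.Icc 0 1) 0 =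
      iteratedDerivWithin j k (Set.Ici 0) 0 := fun j => by
    rw [iteratedDerivWithin_eq_iteratedFDerivWithin, iteratedDerivWithin_eq_iteratedFDerivWithin,
      iteratedFDerivWithin_congr_set hset]
  refine (le_of_eq ?_).trans (h1.trans (mul_le_mul_of_nonneg_right (le_abs_self C)
    (pow_nonneg ht.1 _)))
  congr 2
  refine Finset.sum_congr rfl fun j _ => ?_
  rw [h2, taylorCoef, Complex.real_smul]
  push_cast
  ring

/-- The standard primitive of `T ^ (α - j)`. -/
noncomputable def powPrimitive (α : ℂ) (j : ℕ) (T : ℝ) : ℂ :=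
  if α + 1 = j then (Real.log T : ℂ) else (T : ℂ) ^ (α + 1 - j) / (α + 1 - j)

theorem hasDerivAt_cpow_const {β : ℂ} {x : ℝ} (hx : 0 < x) :
    HasDerivAt (fun t : ℝ => (t : ℂ) ^ β) (β * (x : ℂ) ^ (β - 1)) x := by
  have := ((hasDerivAt_id (x : ℂ)).cpow_const (c := β) (Or.inl (by simpa using hx))).comp_ofReal
  simpa using this

theorem hasDerivAt_ofReal_log {x : ℝ} (hx : 0 < x) :
    HasDerivAt (fun t : ℝ => (Real.log t : ℂ)) (x : ℂ)⁻¹ x := by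
  simpa using (Real.hasDerivAt_log hx.ne').ofReal_comp

theorem hasDerivAt_powPrimitive (α : ℂ) (j : ℕ) {x : ℝ} (hx : 0 < x) :
    HasDerivAt (powPrimitive α j) ((x : ℂ) ^ (α - j)) x := by
  by_cases h : α + 1 = j
  · have e : powPrimitive α j = fun t : ℝ => (Real.log t : ℂ) := by
      funext t
      rw [powPrimitive, if_pos h]
    rw [e, show α - j = -1 by rw [← h]; ring, Complex.cpow_neg_one]
    exact hasDerivAt_ofReal_log hx
  · have e : powPrimitive α j = fun t : ℝ => (t : ℂ) ^ (α + 1 - j) / (α + 1 - j) := by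
      funext t
      rw [powPrimitive, if_neg h]
    have h0 : α + 1 - j ≠ 0 := sub_ne_zero.2 h
    rw [e]
    refine ((hasDerivAt_cpow_const (β := α + 1 - j) hx).div_const (α + 1 - j)).congr_deriv ?_
    rw [mul_div_cancel_left₀ _ h0]
    congr 1
    ring

theorem continuousOn_cpow_Ioi (β : ℂ) :
    ContinuousOn (fun t : ℝ => (t : ℂ) ^ β) (Set.Ioi 0) := fun _ hx =>
  (hasDerivAt_cpow_const hx).continuousAt.continuousWithinAt

theorem ofReal_mul_cpow {x y : ℝ} (hx : 0 < x) (hy : 0 < y) (β : ℂ) :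
    ((x * y : ℝ) : ℂ) ^ β = (x : ℂ) ^ β * (y : ℂ) ^ β := by
  rw [Complex.ofReal_mul, Complex.mul_cpow_ofReal_nonneg hx.le hy.le]

theorem hasRegLimAtTop_powPrimitive (α : ℂ) (j : ℕ) {ρ : ℝ} (hρ : 0 < ρ) :
    HasRegLimAtTop (fun R => powPrimitive α j (ρ * R))
      (if α + 1 = j then (Real.log ρ : ℂ) else 0) := by
  by_cases h : α + 1 = j
  · rw [if_pos h]
    have h1 := (HasRegLimAtTop.const (Real.log ρ)).add (HasRegLimAtTop.cpow_mul_log 0)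
    rw [add_zero] at h1
    refine h1.congr' ?_
    filter_upwards [eventually_gt_atTop 0] with R hR
    rw [powPrimitive, if_pos h, Real.log_mul hρ.ne' hR.ne']
    simp
  · rw [if_neg h]
    have h1 := (HasRegLimAtTop.cpow (sub_ne_zero.2 h)).const_mul
      ((ρ : ℂ) ^ (α + 1 - j) / (α + 1 - j))
    rw [mul_zero] at h1
    refine h1.congr' ?_
    filter_upwards [eventually_gt_atTop 0] with R hR
    rw [powPrimitive, if_neg h, ofReal_mul_cpow hρ hR]
    ring

theorem hasRegLimAtTop_cpow_mul_powPrimitive {α : ℂ} (hα : α + 2 ≠ 0) (j : ℕ) {ρ : ℝ}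
    (hρ : 0 < ρ) :
    HasRegLimAtTop (fun R => (R : ℂ) ^ (-(α + 2)) * powPrimitive α j (ρ * R)) 0 := by
  by_cases h : α + 1 = j
  · have h1 := ((HasRegLimAtTop.cpow (neg_ne_zero.2 hα)).const_mul (Real.log ρ)).add
      (HasRegLimAtTop.cpow_mul_log (-(α + 2)))
    rw [add_zero, mul_zero] at h1
    refine h1.congr' ?_
    filter_upwards [eventually_gt_atTop 0] with R hR
    rw [powPrimitive, if_pos h, Real.log_mul hρ.ne' hR.ne']
    push_cast
    ring
  · have h1 := (HasRegLimAtTop.cpow (β := -((j : ℂ) + 1))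
      (neg_ne_zero.2 (Nat.cast_add_one_ne_zero j))).const_mul
      ((ρ : ℂ) ^ (α + 1 - j) / (α + 1 - j))
    rw [mul_zero] at h1
    refine h1.congr' ?_
    filter_upwards [eventually_gt_atTop 0] with R hR
    rw [powPrimitive, if_neg h, ofReal_mul_cpow hρ hR,
      show -((j : ℂ) + 1) = -(α + 2) + (α + 1 - j) by ring,
      Complex.cpow_add _ _ (by exact_mod_cast hR.ne')]
    ring

theorem tendsto_cpow_mul_of_norm_le {r : ℝ → ℂ} {β : ℂ} {M γ : ℝ} (h : β.re + γ < 0)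
    (hr : ∀ᶠ T in atTop, ‖r T‖ ≤ M * T ^ γ) :
    Tendsto (fun T : ℝ => (T : ℂ) ^ β * r T) atTop (nhds 0) := by
  have h1 : Tendsto (fun T : ℝ => M * T ^ (β.re + γ)) atTop (nhds 0) := by
    have := (tendsto_rpow_neg_atTop (neg_pos.2 h)).const_mul M
    simpa using this
  refine squeeze_zero_norm' ?_ h1
  filter_upwards [hr, eventually_gt_atTop 0] with T hT hT0
  rw [norm_mul, Complex.norm_cpow_eq_rpow_re_of_pos hT0, Real.rpow_add hT0]
  calc _ ≤ T ^ β.re * (M * T ^ γ) :=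
        mul_le_mul_of_nonneg_left hT (Real.rpow_nonneg hT0.le _)
    _ = _ := by ring

/-- Expansion at infinity of the primitive of a function `h u = u ^ α * k u⁻¹`. -/
theorem exists_primitive_expansion {h k : ℝ → ℂ} {α : ℂ}
    (hk : ContDiffOn ℝ (⊤ : ℕ∞) k (Set.Ici 0)) (hh : ContinuousOn h (Set.Ici 0))
    (hhk : ∀ u : ℝ, 0 < u → h u = (u : ℂ) ^ α * k u⁻¹) :
    ∃ (C : ℂ) (N : ℕ) (r : ℝ → ℂ) (M : ℝ), α.re + 1 < N ∧
      (∀ T : ℝ, ∫ u in (1 : ℝ)..T, h u =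
        C + ∑ j ∈ Finset.range N, taylorCoef k j * powPrimitive α j T + r T) ∧
      ∀ᶠ T : ℝ in atTop, ‖r T‖ ≤ M * T ^ (α.re - N + 1) := by
  obtain ⟨n, hn⟩ := exists_nat_gt (α.re + 1)
  obtain ⟨B, hB0, hB⟩ := exists_taylorCoef_bound hk n
  set N := n + 1 with hNdef
  have hN : α.re + 1 < N := by
    rw [hNdef]
    push_cast
    linarith
  set γ : ℝ := α.re - N with hγ
  have hγ1 : γ < -1 := by rw [hγ]; linarith
  set m : ℝ → ℂ := fun u => ∑ j ∈ Finset.range N, taylorCoef k j * (u : ℂ) ^ (α - j) with hm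
  set Ψ : ℝ → ℂ := fun u => ∑ j ∈ Finset.range N, taylorCoef k j * powPrimitive α j u with hΨ
  have hmc : ContinuousOn m (Set.Ioi 0) :=
    continuousOn_finsetSum _ fun j _ => (continuousOn_cpow_Ioi _).const_mul _
  have hΨd : ∀ x : ℝ, 0 < x → HasDerivAt Ψ (m x) x := fun x hx =>
    HasDerivAt.fun_sum fun j _ => (hasDerivAt_powPrimitive α j hx).const_mul _
  set q : ℝ → ℂ := fun u => h u - m u with hq
  have hqc : ContinuousOn q (Set.Ioi 0) := (hh.mono Set.Ioi_subset_Ici_self).sub hmc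
  have hqb : ∀ u : ℝ, 1 ≤ u → ‖q u‖ ≤ B * u ^ γ := by
    intro u hu
    have hu0 : 0 < u := by linarith
    have e : q u = (u : ℂ) ^ α *
        (k u⁻¹ - ∑ j ∈ Finset.range N, taylorCoef k j * ((u⁻¹ : ℝ) : ℂ) ^ j) := by
      simp only [hq, hm]
      rw [hhk u hu0, mul_sub, Finset.mul_sum]
      congr 1
      refine Finset.sum_congr rfl fun j _ => ?_
      rw [Complex.cpow_sub _ _ (by exact_mod_cast hu0.ne'), Complex.cpow_natCast]
      push_cast
      rw [inv_pow]
      ring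
    rw [e, norm_mul, Complex.norm_cpow_eq_rpow_re_of_pos hu0]
    refine (mul_le_mul_of_nonneg_left (hB u⁻¹ ⟨by positivity, inv_le_one_of_one_le₀ hu⟩)
      (Real.rpow_nonneg hu0.le _)).trans (le_of_eq ?_)
    rw [hγ, Real.rpow_sub hu0, Real.rpow_natCast, inv_pow]
    ring
  have hbint : ∀ T : ℝ, 1 ≤ T → IntegrableOn (fun u : ℝ => B * u ^ γ) (Set.Ioi T) := fun T hT =>
    (integrableOn_Ioi_rpow_of_lt hγ1 (by linarith)).const_mul B
  have hqi : ∀ T : ℝ, 1 ≤ T → IntegrableOn q (Set.Ioi T) := by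
    intro T hT
    refine Integrable.mono' (hbint T hT) ?_ ?_
    · exact (hqc.mono fun x hx => lt_of_lt_of_le (by linarith) (le_of_lt hx)).aestronglyMeasurable
        measurableSet_Ioi
    · exact (ae_restrict_mem measurableSet_Ioi).mono fun u hu => hqb u (hT.trans (le_of_lt hu))
  set C : ℂ := (∫ u in Set.Ioi 1, q u) - Ψ 1 with hC
  refine ⟨C, N, fun T => (∫ u in (1 : ℝ)..T, h u) - C - Ψ T, B / -(γ + 1), hN,
    fun T => by ring, ?_⟩
  filter_upwards [eventually_ge_atTop 1] with T hT
  have hT0 : 0 < T := by linarith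
  have hsub : Set.uIcc 1 T ⊆ Set.Ioi 0 := fun x hx => (lt_min one_pos hT0).trans_le hx.1
  have e1 : ∫ u in (1 : ℝ)..T, h u = (∫ u in (1 : ℝ)..T, q u) + (Ψ T - Ψ 1) := by
    rw [← integral_eq_sub_of_primitive hmc hΨd one_pos hT0, ← intervalIntegral.integral_add
      (hqc.mono hsub).intervalIntegrable (hmc.mono hsub).intervalIntegrable]
    simp [hq]
  have e2 : ∫ u in (1 : ℝ)..T, q u = (∫ u in Set.Ioi 1, q u) - ∫ u in Set.Ioi T, q u :=
    (intervalIntegral.integral_Ioi_sub_Ioi (hqi 1 le_rfl) hT).symm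
  have e3 : (∫ u in (1 : ℝ)..T, h u) - C - Ψ T = -∫ u in Set.Ioi T, q u := by
    rw [e1, e2, hC]
    ring
  rw [e3, norm_neg]
  refine (norm_integral_le_of_norm_le (hbint T hT)
    ((ae_restrict_mem measurableSet_Ioi).mono fun u hu => hqb u (hT.trans (le_of_lt hu)))).trans
    (le_of_eq ?_)
  rw [integral_const_mul, integral_Ioi_rpow_of_lt hγ1 hT0]
  rw [neg_div, div_neg]
  ring

/-- Regularized limits at infinity of the primitive of a function `h u = u ^ α * k u⁻¹`. -/
theorem exists_hasRegLimAtTop_primitive {h k : ℝ → ℂ} {α : ℂ} (hα : α + 2 ≠ 0)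
    (hk : ContDiffOn ℝ (⊤ : ℕ∞) k (Set.Ici 0)) (hh : ContinuousOn h (Set.Ici 0))
    (hhk : ∀ u : ℝ, 0 < u → h u = (u : ℂ) ^ α * k u⁻¹) :
    ∃ C : ℂ, ∀ ρ : ℝ, 0 < ρ →
      HasRegLimAtTop (fun R => ∫ u in (1 : ℝ)..ρ * R, h u) (C + critCoef k α * Real.log ρ) ∧
      HasRegLimAtTop (fun R => (R : ℂ) ^ (-(α + 2)) * ∫ u in (1 : ℝ)..ρ * R, h u) 0 := by
  obtain ⟨C, N, r, M, hN, hL, hr⟩ := exists_primitive_expansion hk hh hhk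
  refine ⟨C, fun ρ hρ => ?_⟩
  have hscale : Tendsto (fun R : ℝ => ρ * R) atTop atTop := tendsto_id.const_mul_atTop hρ
  have hr' : ∀ᶠ R : ℝ in atTop, ‖r (ρ * R)‖ ≤ M * ρ ^ (α.re - N + 1) * R ^ (α.re - N + 1) := by
    filter_upwards [hscale.eventually hr, eventually_gt_atTop 0] with R hR hR0
    rwa [Real.mul_rpow hρ.le hR0.le, ← mul_assoc] at hR
  constructor
  · have h1 := ((HasRegLimAtTop.const C).add (HasRegLimAtTop.sum (Finset.range N) fun j _ =>
      (hasRegLimAtTop_powPrimitive α j hρ).const_mul (taylorCoef k j))).add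
      (HasRegLimAtTop.of_tendsto (tendsto_cpow_mul_of_norm_le (β := 0)
        (by simp only [Complex.zero_re]; linarith) hr'))
    rw [sum_taylorCoef_mul_ite k hN, add_zero] at h1
    refine h1.congr' (Eventually.of_forall fun R => ?_)
    simp only [hL, Complex.cpow_zero, one_mul]
  · have h1 := (((HasRegLimAtTop.cpow (neg_ne_zero.2 hα)).const_mul C).add
      (HasRegLimAtTop.sum (Finset.range N) fun j _ =>
      (hasRegLimAtTop_cpow_mul_powPrimitive hα j hρ).const_mul (taylorCoef k j))).add
      (HasRegLimAtTop.of_tendsto (tendsto_cpow_mul_of_norm_le (β := -(α + 2))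
        (by
          have : (0 : ℝ) ≤ N := Nat.cast_nonneg N
          simp only [Complex.neg_re, Complex.add_re, Complex.re_ofNat]
          linarith) hr'))
    simp only [mul_zero, Finset.sum_const_zero, add_zero] at h1
    refine h1.congr' (Eventually.of_forall fun R => ?_)
    simp only [hL, mul_add, Finset.mul_sum]
    congr 1
    congr 1
    · ring
    · exact Finset.sum_congr rfl fun j _ => by ring

/-- Regularized limit of `R ^ (α + 2)` times the primitive of a smooth function near `0`. -/
theorem hasRegLimAtTop_cpow_mul_primitive_div {h : ℝ → ℂ} {α : ℂ} (hα : α + 2 ≠ 0)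
    (hh : ContDiffOn ℝ (⊤ : ℕ∞) h (Set.Ici 0)) {b : ℝ} (hb : 0 < b) :
    HasRegLimAtTop (fun R => (R : ℂ) ^ (α + 2) * ∫ u in (1 : ℝ)..b / R, h u)
      (critCoef h α * ((b : ℂ) ^ (α + 2) / (α + 2))) := by
  obtain ⟨n, hn⟩ := exists_nat_gt (α.re + 1)
  obtain ⟨B, hB0, hB⟩ := exists_taylorCoef_bound hh n
  set N := n + 1 with hNdef
  have hN : α.re + 1 < N := by
    rw [hNdef]
    push_cast
    linarith
  have hint : ∀ s t : ℝ, 0 ≤ s → 0 ≤ t → IntervalIntegrable h volume s t := fun s t hs ht =>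
    (hh.continuousOn.mono fun x hx => (le_min hs ht).trans hx.1).intervalIntegrable
  set m : ℝ → ℂ := fun u => ∑ j ∈ Finset.range N, taylorCoef h j * (u : ℂ) ^ j with hm
  have hmc : Continuous m := by fun_prop
  set r : ℝ → ℂ := fun R => ∫ u in (0 : ℝ)..b / R, (h u - m u) with hr
  have hmi : ∀ s : ℝ, ∫ u in (0 : ℝ)..s, m u =
      ∑ j ∈ Finset.range N, taylorCoef h j * ((s : ℂ) ^ (j + 1) / (j + 1)) := by
    intro s
    rw [intervalIntegral.integral_finsetSum fun j _ => by
      apply Continuous.intervalIntegrable; fun_prop]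
    refine Finset.sum_congr rfl fun j _ => ?_
    rw [intervalIntegral.integral_const_mul]
    congr 1
    have := integral_pow (a := 0) (b := s) j
    have h2 : ∫ u in (0 : ℝ)..s, (u : ℂ) ^ j = ((∫ u in (0 : ℝ)..s, u ^ j : ℝ) : ℂ) := by
      rw [← intervalIntegral.integral_ofReal]
      simp
    rw [h2, this]
    push_cast
    simp
  have hterm : ∀ j : ℕ, HasRegLimAtTop
      (fun R => (R : ℂ) ^ (α + 2) * (((b / R : ℝ) : ℂ) ^ (j + 1) / (j + 1)))
      (if α + 1 = j then (b : ℂ) ^ (α + 2) / (α + 2) else 0) := by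
    intro j
    have hcongr : (fun R : ℝ => (b : ℂ) ^ (j + 1) / (j + 1) * (R : ℂ) ^ (α + 1 - j)) =ᶠ[atTop]
        fun R => (R : ℂ) ^ (α + 2) * (((b / R : ℝ) : ℂ) ^ (j + 1) / (j + 1)) := by
      filter_upwards [eventually_gt_atTop 0] with R hR
      have hR0 : (R : ℂ) ≠ 0 := by exact_mod_cast hR.ne'
      rw [show α + 1 - j = α + 2 - ((j + 1 : ℕ) : ℂ) by push_cast; ring, Complex.cpow_sub _ _ hR0,
        Complex.cpow_natCast]
      push_cast
      rw [div_pow]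
      ring
    by_cases hj : α + 1 = j
    · rw [if_pos hj]
      refine HasRegLimAtTop.congr' ?_ hcongr
      rw [show α + 2 = ((j + 1 : ℕ) : ℂ) by push_cast; rw [← hj]; ring, Complex.cpow_natCast,
        ← hj]
      simp only [sub_self, Complex.cpow_zero, mul_one]
      convert HasRegLimAtTop.const _ using 2
      rw [hj]
      push_cast
      ring
    · rw [if_neg hj]
      have h1 := (HasRegLimAtTop.cpow (sub_ne_zero.2 hj)).const_mul ((b : ℂ) ^ (j + 1) / (j + 1))
      rw [mul_zero] at h1
      exact h1.congr' hcongr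
  have hrb : ∀ᶠ R : ℝ in atTop, ‖r R‖ ≤ B * b ^ (N + 1) * R ^ (-(N + 1 : ℝ)) := by
    filter_upwards [eventually_ge_atTop b, eventually_gt_atTop 0] with R hRb hR
    have hs0 : 0 ≤ b / R := by positivity
    have hs1 : b / R ≤ 1 := (div_le_one hR).2 hRb
    have h1 : ‖r R‖ ≤ B * (b / R) ^ N * |b / R - 0| := by
      refine intervalIntegral.norm_integral_le_of_norm_le_const fun u hu => ?_
      rw [Set.uIoc_of_le hs0] at hu
      refine (hB u ⟨hu.1.le, hu.2.trans hs1⟩).trans ?_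
      exact mul_le_mul_of_nonneg_left (pow_le_pow_left₀ hu.1.le hu.2 _) hB0
    refine h1.trans (le_of_eq ?_)
    rw [sub_zero, abs_of_nonneg hs0, Real.rpow_neg hR.le,
      show (N + 1 : ℝ) = ((N + 1 : ℕ) : ℝ) by push_cast; ring, Real.rpow_natCast, div_pow,
      pow_succ b N, pow_succ R N]
    field_simp
  have h1 := (((HasRegLimAtTop.cpow hα).const_mul (∫ u in (1 : ℝ)..0, h u)).add
    (HasRegLimAtTop.sum (Finset.range N) fun j _ =>
      (hterm j).const_mul (taylorCoef h j))).add
    (HasRegLimAtTop.of_tendsto (tendsto_cpow_mul_of_norm_le (β := α + 2)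
      (by
        simp only [Complex.add_re, Complex.re_ofNat]
        linarith) hrb))
  rw [sum_taylorCoef_mul_ite h hN, mul_zero, zero_add, add_zero] at h1
  refine h1.congr' ?_
  filter_upwards [eventually_gt_atTop 0] with R hR
  have hs0 : 0 ≤ b / R := by positivity
  have e1 : r R = (∫ u in (0 : ℝ)..b / R, h u) - ∫ u in (0 : ℝ)..b / R, m u :=
    intervalIntegral.integral_sub (hint _ _ le_rfl hs0) (hmc.intervalIntegrable _ _)
  rw [← intervalIntegral.integral_add_adjacent_intervals (hint 1 0 zero_le_one le_rfl)
    (hint 0 (b / R) le_rfl hs0), e1, hmi, mul_sub, mul_add, Finset.mul_sum]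
  simp only [mul_left_comm (taylorCoef h _)]
  ring

/-- A regularized integral computed from a primitive whose regularized limit at `0` is its
value there. -/
theorem HasRegInt.eq_sub_of_primitive_nonneg {g Φ : ℝ → ℂ} {a : ℝ} {v w : ℂ} (ha : 0 ≤ a)
    (hg : ContinuousOn g (Set.Ioi 0)) (hΦ : ∀ x : ℝ, 0 < x → HasDerivAt Φ (g x) x)
    (hw : HasRegLimAtTop Φ w) (hw₀ : HasRegLimAtTop (fun R => Φ R⁻¹) (Φ 0))
    (h : HasRegInt g a v) : v = w - Φ a := by
  rcases ha.eq_or_lt with rfl | ha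
  · exact h.eq_sub_of_primitive_zero hg hΦ hw hw₀
  · exact h.eq_sub_of_primitive ha hg hΦ hw

theorem hasDerivAt_primitive {h : ℝ → ℂ} (hh : ContinuousOn h (Set.Ici 0)) {x : ℝ} (hx : 0 < x) :
    HasDerivAt (fun T => ∫ u in (1 : ℝ)..T, h u) (h x) x := by
  refine intervalIntegral.integral_hasDerivAt_right ?_ ?_ (hh.continuousAt (Ici_mem_nhds hx))
  · exact (hh.mono fun y hy => (le_min zero_le_one hx.le).trans hy.1).intervalIntegrable
  · exact (hh.mono Set.Ioi_subset_Ici_self).stronglyMeasurableAtFilter isOpen_Ioi x hx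

theorem tendsto_primitive_div {h : ℝ → ℂ} (hh : ContinuousOn h (Set.Ici 0)) {ρ : ℝ} (hρ : 0 ≤ ρ) :
    Tendsto (fun R => ∫ u in (1 : ℝ)..ρ / R, h u) atTop (nhds (∫ u in (1 : ℝ)..0, h u)) := by
  have hint : IntervalIntegrable h volume 0 1 :=
    (hh.mono fun y hy => (le_min le_rfl zero_le_one).trans hy.1).intervalIntegrable
  have hc := intervalIntegral.continuousOn_primitive_interval' hint Set.right_mem_uIcc 0
    Set.left_mem_uIcc
  refine hc.tendsto.comp (tendsto_nhdsWithin_iff.2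
    ⟨tendsto_const_nhds.div_atTop tendsto_id, ?_⟩)
  filter_upwards [eventually_ge_atTop ρ, eventually_gt_atTop 0] with R hR hR0
  rw [Set.uIcc_of_le zero_le_one]
  exact ⟨by positivity, (div_le_one hR0).2 hR⟩

/-- Regularized integral of a function continuous on the closed half line. -/
theorem HasRegInt.eq_sub_integral {g : ℝ → ℂ} {a : ℝ} {v w : ℂ} (ha : 0 ≤ a)
    (hg : ContinuousOn g (Set.Ici 0)) (hw : HasRegLimAtTop (fun R => ∫ u in (1 : ℝ)..R, g u) w)
    (h : HasRegInt g a v) : v = w - ∫ u in (1 : ℝ)..a, g u := by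
  refine h.eq_sub_of_primitive_nonneg (Φ := fun T => ∫ u in (1 : ℝ)..T, g u) ha
    (hg.mono Set.Ioi_subset_Ici_self) (fun x hx => hasDerivAt_primitive hg hx) hw ?_
  simpa using HasRegLimAtTop.of_tendsto (tendsto_primitive_div hg zero_le_one)

theorem ofReal_inv_cpow {R : ℝ} (hR : 0 < R) (β : ℂ) :
    ((R⁻¹ : ℝ) : ℂ) ^ β = (R : ℂ) ^ (-β) := by
  rw [Complex.ofReal_inv, Complex.inv_cpow, Complex.cpow_neg]
  rw [Complex.arg_ofReal_of_nonneg hR.le]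
  exact Real.pi_pos.ne

/-- The standard primitive of `x ^ (β - 1) * log x`. -/
noncomputable def powLogPrimitive (β : ℂ) (x : ℝ) : ℂ :=
  (x : ℂ) ^ β * (Real.log x : ℂ) / β - (x : ℂ) ^ β / β ^ 2

theorem hasDerivAt_powLogPrimitive {β : ℂ} (hβ : β ≠ 0) {x : ℝ} (hx : 0 < x) :
    HasDerivAt (powLogPrimitive β) ((x : ℂ) ^ (β - 1) * Real.log x) x := by
  have h1 := hasDerivAt_cpow_const (β := β) hx
  refine (((h1.mul (hasDerivAt_ofReal_log hx)).div_const β).sub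
    (h1.div_const (β ^ 2))).congr_deriv ?_
  have hx0 : (x : ℂ) ≠ 0 := by exact_mod_cast hx.ne'
  rw [Complex.cpow_sub _ _ hx0, Complex.cpow_one]
  field_simp
  ring

theorem hasRegLimAtTop_powLogPrimitive {β : ℂ} (hβ : β ≠ 0) :
    HasRegLimAtTop (powLogPrimitive β) 0 := by
  have h1 := ((HasRegLimAtTop.cpow_mul_log β).const_mul β⁻¹).sub
    ((HasRegLimAtTop.cpow hβ).const_mul (β ^ 2)⁻¹)
  simp only [mul_zero, sub_zero] at h1
  refine h1.congr' (Eventually.of_forall fun R => ?_)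
  rw [powLogPrimitive]
  ring

theorem hasRegLimAtTop_powLogPrimitive_inv {β : ℂ} (hβ : β ≠ 0) :
    HasRegLimAtTop (fun R => powLogPrimitive β R⁻¹) 0 := by
  have h1 := ((HasRegLimAtTop.cpow_mul_log (-β)).const_mul (-β⁻¹)).sub
    ((HasRegLimAtTop.cpow (neg_ne_zero.2 hβ)).const_mul (β ^ 2)⁻¹)
  simp only [mul_zero, sub_zero] at h1
  refine h1.congr' ?_
  filter_upwards [eventually_gt_atTop 0] with R hR
  rw [powLogPrimitive, ofReal_inv_cpow hR, Real.log_inv]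
  push_cast
  ring

theorem powLogPrimitive_zero {β : ℂ} (hβ : β ≠ 0) : powLogPrimitive β 0 = 0 := by
  simp [powLogPrimitive, Complex.zero_cpow hβ]

theorem HasRegInt.cpow_mul_log {α : ℂ} (hα : α + 2 ≠ 0) {a : ℝ} (ha : 0 ≤ a) {v : ℂ}
    (h : HasRegInt (fun x => (x : ℂ) ^ (α + 1) * Real.log x) a v) :
    v = -powLogPrimitive (α + 2) a := by
  rw [← zero_sub]
  refine h.eq_sub_of_primitive_nonneg ha ?_ (fun x hx => ?_) (hasRegLimAtTop_powLogPrimitive hα) ?_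
  · exact (continuousOn_cpow_Ioi _).mul fun x hx =>
      (hasDerivAt_ofReal_log hx).continuousAt.continuousWithinAt
  · convert hasDerivAt_powLogPrimitive hα hx using 3
    ring
  · rw [powLogPrimitive_zero hα]
    exact hasRegLimAtTop_powLogPrimitive_inv hα

/-- The primitive of `(α + 2) * x ^ (α + 1) * ∫ u in 1..b / x, h u`, when
`h u = u ^ α * k u⁻¹`. -/
noncomputable def mixedPrimitive (h k : ℝ → ℂ) (α : ℂ) (b x : ℝ) : ℂ :=
  (x : ℂ) ^ (α + 2) * (∫ u in (1 : ℝ)..b / x, h u) +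
    (b : ℂ) ^ (α + 2) * ∫ u in (1 : ℝ)..x / b, k u

theorem hasDerivAt_primitive_div {h : ℝ → ℂ} (hh : ContinuousOn h (Set.Ici 0)) {b x : ℝ}
    (hb : 0 ≤ b) (hx : 0 < x) :
    HasDerivAt (fun x => ∫ u in (1 : ℝ)..b / x, h u) (-(b / x ^ 2 : ℝ) * h (b / x)) x := by
  rcases hb.eq_or_lt with rfl | hb
  · simpa using hasDerivAt_const x (∫ u in (1 : ℝ)..0, h u)
  · have h1 : HasDerivAt (fun x : ℝ => b / x) (-(b / x ^ 2)) x := by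
      have := (hasDerivAt_inv hx.ne').const_mul b
      simpa [div_eq_mul_inv] using this
    have h2 := (hasDerivAt_primitive hh (div_pos hb hx)).scomp x h1
    simpa [Function.comp_def] using h2

theorem hasDerivAt_mixedPrimitive {h k : ℝ → ℂ} {α : ℂ} (hα : α + 2 ≠ 0)
    (hh : ContinuousOn h (Set.Ici 0)) (hk : ContinuousOn k (Set.Ici 0))
    (hhk : ∀ u : ℝ, 0 < u → h u = (u : ℂ) ^ α * k u⁻¹) {b x : ℝ} (hb : 0 ≤ b) (hx : 0 < x) :
    HasDerivAt (mixedPrimitive h k α b)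
      ((α + 2) * ((x : ℂ) ^ (α + 1) * ∫ u in (1 : ℝ)..b / x, h u)) x := by
  have hx0 : (x : ℂ) ≠ 0 := by exact_mod_cast hx.ne'
  have h1 := (hasDerivAt_cpow_const (β := α + 2) hx).mul (hasDerivAt_primitive_div hh hb hx)
  have e1 : α + 2 - 1 = α + 1 := by ring
  rcases hb.eq_or_lt with rfl | hb
  · have e : mixedPrimitive h k α 0 = fun x : ℝ =>
        (x : ℂ) ^ (α + 2) * ∫ u in (1 : ℝ)..0 / x, h u := by
      funext y
      simp [mixedPrimitive, Complex.zero_cpow hα]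
    rw [e]
    refine h1.congr_deriv ?_
    rw [e1]
    simp
    ring
  · have hb0 : (b : ℂ) ≠ 0 := by exact_mod_cast hb.ne'
    have h2 : HasDerivAt (fun x => ∫ u in (1 : ℝ)..x / b, k u) ((b : ℂ)⁻¹ * k (x / b)) x := by
      have := (hasDerivAt_primitive hk (div_pos hx hb)).scomp x ((hasDerivAt_id x).div_const b)
      simpa [Function.comp_def] using this
    refine (h1.add (h2.const_mul ((b : ℂ) ^ (α + 2)))).congr_deriv ?_
    have hpow : ∀ z : ℂ, z ≠ 0 → z ^ (α + 2) = z ^ α * z ^ 2 := fun z hz => by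
      rw [Complex.cpow_add _ _ hz, Complex.cpow_ofNat]
    rw [hhk _ (div_pos hb hx), inv_div, e1, div_eq_mul_inv b x, ofReal_mul_cpow hb (inv_pos.2 hx),
      ofReal_inv_cpow hx, hpow _ hx0, hpow _ hb0, Complex.cpow_neg]
    have hxα : (x : ℂ) ^ α ≠ 0 := by simp [Complex.cpow_eq_zero_iff, hx0]
    push_cast
    field_simp
    ring

theorem hasRegLimAtTop_mixedPrimitive {h k : ℝ → ℂ} {α C : ℂ} (hα : α + 2 ≠ 0)
    (hh : ContDiffOn ℝ (⊤ : ℕ∞) h (Set.Ici 0))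
    (hC : ∀ ρ : ℝ, 0 < ρ → HasRegLimAtTop (fun R => ∫ u in (1 : ℝ)..ρ * R, k u)
      (C + critCoef h α * Real.log ρ)) {b : ℝ} (hb : 0 ≤ b) :
    HasRegLimAtTop (mixedPrimitive h k α b) (critCoef h α * ((b : ℂ) ^ (α + 2) / (α + 2)) +
      (b : ℂ) ^ (α + 2) * (C - critCoef h α * Real.log b)) := by
  rcases hb.eq_or_lt with rfl | hb
  · have h1 := (HasRegLimAtTop.cpow hα).const_mul (∫ u in (1 : ℝ)..0, h u)
    simp only [mul_zero] at h1
    simp only [Complex.ofReal_zero, Complex.zero_cpow hα, zero_div, mul_zero, zero_mul, add_zero]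
    refine h1.congr' (Eventually.of_forall fun R => ?_)
    simp [mixedPrimitive, Complex.zero_cpow hα, mul_comm]
  · have h1 := (hasRegLimAtTop_cpow_mul_primitive_div hα hh hb).add
      ((hC b⁻¹ (inv_pos.2 hb)).const_mul ((b : ℂ) ^ (α + 2)))
    rw [Real.log_inv, Complex.ofReal_neg, mul_neg, ← sub_eq_add_neg] at h1
    refine h1.congr' (Eventually.of_forall fun R => ?_)
    simp only [mixedPrimitive, div_eq_inv_mul R b]

theorem hasRegLimAtTop_mixedPrimitive_inv {h k : ℝ → ℂ} {α : ℂ} (hα : α + 2 ≠ 0)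
    (hk : ContinuousOn k (Set.Ici 0))
    (hL : ∀ ρ : ℝ, 0 < ρ →
      HasRegLimAtTop (fun R => (R : ℂ) ^ (-(α + 2)) * ∫ u in (1 : ℝ)..ρ * R, h u) 0)
    {b : ℝ} (hb : 0 ≤ b) :
    HasRegLimAtTop (fun R => mixedPrimitive h k α b R⁻¹) (mixedPrimitive h k α b 0) := by
  have h0 : mixedPrimitive h k α b 0 =
      0 + (b : ℂ) ^ (α + 2) * ∫ u in (1 : ℝ)..0, k u := by
    simp [mixedPrimitive, Complex.zero_cpow hα]
  have h1 : HasRegLimAtTop (fun R => (R : ℂ) ^ (-(α + 2)) * ∫ u in (1 : ℝ)..b * R, h u) 0 := by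
    rcases hb.eq_or_lt with rfl | hb
    · have := (HasRegLimAtTop.cpow (neg_ne_zero.2 hα)).const_mul (∫ u in (1 : ℝ)..0, h u)
      simpa [mul_comm] using this
    · exact hL b hb
  rw [h0]
  refine (h1.add ((HasRegLimAtTop.of_tendsto (tendsto_primitive_div hk
    (inv_nonneg.2 hb))).const_mul ((b : ℂ) ^ (α + 2)))).congr' ?_
  filter_upwards [eventually_gt_atTop 0] with R hR
  simp only [mixedPrimitive]
  rw [ofReal_inv_cpow hR, div_inv_eq_mul, inv_div_comm]

theorem Homog.eq_cpow_mul {f : ℝ × ℝ → ℂ} {α : ℂ} (hf : Homog f α) {x y : ℝ} (hx : 0 < x)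
    (hy : 0 ≤ y) : f (x, y) = (x : ℂ) ^ α * f (1, y / x) := by
  have := hf x hx (1, y / x) ⟨⟨zero_le_one, by positivity⟩, by simp⟩
  rwa [mul_one, mul_div_cancel₀ _ hx.ne'] at this

theorem Homog.comp_swap {f : ℝ × ℝ → ℂ} {α : ℂ} (hf : Homog f α) :
    Homog (fun p => f (p.2, p.1)) α := fun l hl p hp =>
  hf l hl (p.2, p.1) ⟨hp.1.symm, fun h => hp.2 (by
    simp only [Set.mem_singleton_iff, Prod.mk_eq_zero] at h
    exact Prod.ext h.2 h.1)⟩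

theorem contDiffOn_comp_swap {f : ℝ × ℝ → ℂ} (hf : ContDiffOn ℝ (⊤ : ℕ∞) f Qset) :
    ContDiffOn ℝ (⊤ : ℕ∞) (fun p : ℝ × ℝ => f (p.2, p.1)) Qset := by
  refine hf.comp (t := Qset) (f := fun p : ℝ × ℝ => (p.2, p.1)) (by fun_prop) fun p hp => ?_
  refine ⟨hp.1.symm, fun h => hp.2 ?_⟩
  simp only [Set.mem_singleton_iff, Prod.mk_eq_zero] at h
  exact Prod.ext h.2 h.1

theorem contDiffOn_slice {f : ℝ × ℝ → ℂ} (hf : ContDiffOn ℝ (⊤ : ℕ∞) f Qset) {x : ℝ}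
    (hx : 0 < x) : ContDiffOn ℝ (⊤ : ℕ∞) (fun y => f (x, y)) (Set.Ici 0) :=
  hf.comp (t := Qset) (f := fun y : ℝ => (x, y)) (by fun_prop) fun y hy =>
    ⟨⟨hx.le, hy⟩, fun h => hx.ne' (congrArg Prod.fst h)⟩

theorem Homog.integral_slice {f : ℝ × ℝ → ℂ} {α : ℂ} (hf : Homog f α) {x : ℝ} (hx : 0 < x)
    {s t : ℝ} (hs : 0 ≤ s) (ht : 0 ≤ t) :
    ∫ y in s..t, f (x, y) = (x : ℂ) ^ (α + 1) * ∫ u in s / x..t / x, f (1, u) := by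
  have h1 : ∫ y in s..t, f (x, y) = ∫ y in s..t, (x : ℂ) ^ α * f (1, y / x) :=
    intervalIntegral.integral_congr fun y hy => hf.eq_cpow_mul hx ((le_min hs ht).trans hy.1)
  rw [h1, intervalIntegral.integral_const_mul,
    intervalIntegral.integral_comp_div (fun u => f (1, u)) hx.ne', Complex.real_smul,
    Complex.cpow_add _ _ (by exact_mod_cast hx.ne'), Complex.cpow_one, mul_assoc]

/-- The explicit formula for one order of iterated regularized integration. -/
theorem Homog.iterated_regInt_eq {f : ℝ × ℝ → ℂ} {α : ℂ}
    (hsm : ContDiffOn ℝ (⊤ : ℕ∞) f Qset) (hhom : Homog f α) (hα : α + 2 ≠ 0)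
    {a b : ℝ} (ha : 0 ≤ a) (hb : 0 ≤ b) {F : ℝ → ℂ} {I J₁ J₂ P₁ P₂ : ℂ}
    (hF : ∀ x : ℝ, 0 < x → HasRegInt (fun y => f (x, y)) b (F x)) (hI : HasRegInt F a I)
    (hJ₁ : HasRegInt (fun y => f (1, y)) (b / a) J₁)
    (hJ₂ : HasRegInt (fun x => f (x, 1)) (a / b) J₂)
    (hP₁ : HasRegInt (fun x => (x : ℂ) ^ (α + 1) * Real.log x) a P₁)
    (hP₂ : HasRegInt (fun x => (x : ℂ) ^ (α + 1) * Real.log x) b P₂) :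
    I = (if a = 0 then 0 else -((a : ℂ) ^ (α + 2) / (α + 2)) * J₁)
       + (if b = 0 then 0 else -((b : ℂ) ^ (α + 2) / (α + 2)) * J₂)
       - cCrit f α * P₁ - dCrit f α * P₂ := by
  set h : ℝ → ℂ := fun u => f (1, u) with hh
  set k : ℝ → ℂ := fun v => f (v, 1) with hk
  have hc : cCrit f α = critCoef k α := rfl
  have hd : dCrit f α = critCoef h α := rfl
  have hhs : ContDiffOn ℝ (⊤ : ℕ∞) h (Set.Ici 0) := contDiffOn_slice hsm one_pos
  have hks : ContDiffOn ℝ (⊤ : ℕ∞) k (Set.Ici 0) :=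
    contDiffOn_slice (contDiffOn_comp_swap hsm) one_pos
  have hkh : ∀ v : ℝ, 0 < v → k v = (v : ℂ) ^ α * h v⁻¹ := fun v hv => by
    simpa using hhom.eq_cpow_mul hv zero_le_one
  have hhk : ∀ u : ℝ, 0 < u → h u = (u : ℂ) ^ α * k u⁻¹ := fun u hu => by
    simpa using hhom.comp_swap.eq_cpow_mul hu zero_le_one
  obtain ⟨C, hC⟩ := exists_hasRegLimAtTop_primitive hα hks hhs.continuousOn hhk
  obtain ⟨D, hD⟩ := exists_hasRegLimAtTop_primitive hα hhs hks.continuousOn hkh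
  have eJ₁ : J₁ = C - ∫ u in (1 : ℝ)..b / a, h u :=
    hJ₁.eq_sub_integral (by positivity) hhs.continuousOn (by simpa using (hC 1 one_pos).1)
  have eJ₂ : J₂ = D - ∫ u in (1 : ℝ)..a / b, k u :=
    hJ₂.eq_sub_integral (by positivity) hks.continuousOn (by simpa using (hD 1 one_pos).1)
  have eF : ∀ x : ℝ, 0 < x → F x = (x : ℂ) ^ (α + 1) *
      (C - critCoef k α * Real.log x - ∫ u in (1 : ℝ)..b / x, h u) := by
    intro x hx
    have hint : ∀ t : ℝ, 0 ≤ t → IntervalIntegrable h volume 1 t := fun t ht =>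
      (hhs.continuousOn.mono fun y hy => (le_min zero_le_one ht).trans hy.1).intervalIntegrable
    have e : ∀ t : ℝ, 0 ≤ t → ∫ y in (1 : ℝ)..t, f (x, y) = (x : ℂ) ^ (α + 1) *
        ((∫ u in (1 : ℝ)..t / x, h u) - ∫ u in (1 : ℝ)..1 / x, h u) := fun t ht => by
      rw [hhom.integral_slice hx zero_le_one ht, intervalIntegral.integral_interval_sub_left
        (hint _ (by positivity)) (hint _ (by positivity))]
    have hw : HasRegLimAtTop (fun R => ∫ y in (1 : ℝ)..R, f (x, y)) ((x : ℂ) ^ (α + 1) *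
        (C + critCoef k α * Real.log x⁻¹ - ∫ u in (1 : ℝ)..1 / x, h u)) := by
      refine (((hC x⁻¹ (inv_pos.2 hx)).1.sub (HasRegLimAtTop.const _)).const_mul _).congr' ?_
      filter_upwards [eventually_ge_atTop 0] with R hR
      rw [e R hR, div_eq_inv_mul R x]
    rw [(hF x hx).eq_sub_integral hb (contDiffOn_slice hsm hx).continuousOn hw, e b hb,
      Real.log_inv]
    push_cast
    ring
  set Φ : ℝ → ℂ := fun x => C / (α + 2) * (x : ℂ) ^ (α + 2) -
    critCoef k α * powLogPrimitive (α + 2) x - (α + 2)⁻¹ * mixedPrimitive h k α b x with hΦ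
  have e1 : α + 2 - 1 = α + 1 := by ring
  have hFc : ContinuousOn F (Set.Ioi 0) := by
    refine ContinuousOn.congr ?_ eF
    refine (continuousOn_cpow_Ioi _).mul ((continuousOn_const.sub (continuousOn_const.mul
      fun x hx => ?_)).sub fun x hx => ?_)
    · exact (hasDerivAt_ofReal_log hx).continuousAt.continuousWithinAt
    · exact (hasDerivAt_primitive_div hhs.continuousOn hb hx).continuousAt.continuousWithinAt
  have hΦd : ∀ x : ℝ, 0 < x → HasDerivAt Φ (F x) x := by
    intro x hx
    refine ((((hasDerivAt_cpow_const (β := α + 2) hx).const_mul (C / (α + 2))).sub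
      ((hasDerivAt_powLogPrimitive hα hx).const_mul (critCoef k α))).sub
      ((hasDerivAt_mixedPrimitive hα hhs.continuousOn hks.continuousOn hhk hb hx).const_mul
        (α + 2)⁻¹)).congr_deriv ?_
    rw [eF x hx, e1]
    field_simp
  have hΦt := (((HasRegLimAtTop.cpow hα).const_mul (C / (α + 2))).sub
    ((hasRegLimAtTop_powLogPrimitive hα).const_mul (critCoef k α))).sub
    ((hasRegLimAtTop_mixedPrimitive hα hhs (fun ρ hρ => (hD ρ hρ).1) hb).const_mul (α + 2)⁻¹)
  have hΦ0 : HasRegLimAtTop (fun R => Φ R⁻¹) (Φ 0) := by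
    have h1 := (((HasRegLimAtTop.cpow (neg_ne_zero.2 hα)).const_mul (C / (α + 2))).sub
      ((hasRegLimAtTop_powLogPrimitive_inv hα).const_mul (critCoef k α))).sub
      ((hasRegLimAtTop_mixedPrimitive_inv hα hks.continuousOn
        (fun ρ hρ => (hC ρ hρ).2) hb).const_mul (α + 2)⁻¹)
    have e0 : Φ 0 = C / (α + 2) * 0 - critCoef k α * 0 -
        (α + 2)⁻¹ * mixedPrimitive h k α b 0 := by
      simp only [hΦ, powLogPrimitive_zero hα, Complex.ofReal_zero, Complex.zero_cpow hα]
    rw [e0]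
    refine h1.congr' ?_
    filter_upwards [eventually_gt_atTop 0] with R hR
    simp only [hΦ, ofReal_inv_cpow hR]
  have eI := hI.eq_sub_of_primitive_nonneg ha hFc hΦd hΦt hΦ0
  have eif : ∀ (t : ℝ) (z : ℂ), (if t = 0 then 0 else -((t : ℂ) ^ (α + 2) / (α + 2)) * z) =
      -((t : ℂ) ^ (α + 2) / (α + 2)) * z := by
    intro t z
    split_ifs with ht
    · simp [ht, Complex.zero_cpow hα]
    · rfl
  rw [eif, eif, eI, eJ₁, eJ₂, hc, hd, hP₁.cpow_mul_log hα ha, hP₂.cpow_mul_log hα hb]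
  simp only [hΦ, mixedPrimitive, powLogPrimitive]
  field_simp
  ring


/-- Lemma `LHomDoubleInt`, part 1 (non-critical case `α + 2 ≠ 0`): iterated regularized
integrals of a homogeneous function agree for both orders of integration and are given by
the explicit formula; terms corresponding to `a = 0` resp. `b = 0` are interpreted as the
(vanishing) regularized limit. Here `F x = ⨍_b^∞ f(x,y) dy`, `G y = ⨍_a^∞ f(x,y) dx`,
`I₁ = ⨍_a^∞ F`, `I₂ = ⨍_b^∞ G`, `J₁ = ⨍_{b/a}^∞ f(1,y) dy`, `J₂ = ⨍_{a/b}^∞ f(x,1) dx`,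
`P₁ = ⨍_a^∞ x^(α+1) log x dx`, `P₂ = ⨍_b^∞ x^(α+1) log x dx`. -/
theorem stmt_8 (f : ℝ × ℝ → ℂ) (α : ℂ)
    (hsm : ContDiffOn ℝ (⊤ : ℕ∞) f Qset) (hhom : Homog f α) (hα : α + 2 ≠ 0)
    (a b : ℝ) (ha : 0 ≤ a) (hb : 0 ≤ b) (hab : 0 < a + b)
    (F G : ℝ → ℂ) (I₁ I₂ J₁ J₂ P₁ P₂ : ℂ)
    (hF : ∀ x : ℝ, 0 ≤ x → HasRegInt (fun y => f (x, y)) b (F x))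
    (hG : ∀ y : ℝ, 0 ≤ y → HasRegInt (fun x => f (x, y)) a (G y))
    (hI₁ : HasRegInt F a I₁) (hI₂ : HasRegInt G b I₂)
    (hJ₁ : HasRegInt (fun y => f (1, y)) (b / a) J₁)
    (hJ₂ : HasRegInt (fun x => f (x, 1)) (a / b) J₂)
    (hP₁ : HasRegInt (fun x => (x : ℂ) ^ (α + 1) * Real.log x) a P₁)
    (hP₂ : HasRegInt (fun x => (x : ℂ) ^ (α + 1) * Real.log x) b P₂) :
    I₁ = I₂ ∧
    I₁ = (if a = 0 then 0 else -((a : ℂ) ^ (α + 2) / (α + 2)) * J₁)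
       + (if b = 0 then 0 else -((b : ℂ) ^ (α + 2) / (α + 2)) * J₂)
       - cCrit f α * P₁ - dCrit f α * P₂ := by
  have h₁ := hhom.iterated_regInt_eq hsm hα ha hb (fun x hx => hF x hx.le) hI₁ hJ₁ hJ₂ hP₁ hP₂
  have h₂ := hhom.comp_swap.iterated_regInt_eq (contDiffOn_comp_swap hsm) hα hb ha
    (fun y hy => hG y hy.le) hI₂ hJ₂ hJ₁ hP₂ hP₁
  have hc : cCrit (fun p => f (p.2, p.1)) α = dCrit f α := rfl
  have hd : dCrit (fun p => f (p.2, p.1)) α = cCrit f α := rfl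
  refine ⟨?_, h₁⟩
  rw [h₁, h₂, hc, hd]
  ring
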